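/- arXiv:2108.09289 — 9 statements merged into one kernel-verified Lean document; each statement's English description precedes it below -/
import Mathlib

section
/- Fix a lending threshold c ∈ (0,1). Define the truncated Winkler expected utility U(p, p̂) = p·(ln p̂ − ln c)/(−ln c) + (1−p)·(ln(1−p̂) − ln(1−c))/(−ln c) when p̂ > c, and U(p, p̂) = 0 when p̂ ≤ c. Then for every belief p ∈ (c, 1) and every report p̂ ∈ [0, 1) with p̂ ≠ p, one has U(p, p) > U(p, p̂). That is, above the lending threshold the truncated Winkler elicitation mechanism (one recommender, one borrower) is strictly proper. -/
/-- Expected utility of the truncated Winkler elicitation mechanism (one recommender,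
one borrower), built from the logarithmic scoring rule with lending threshold `c`:
if the report `phat` exceeds `c` a loan is made and the recommender is paid by the
Winkler scoring rule; otherwise the payment is `0`. -/
noncomputable def truncWinklerU (c p phat : ℝ) : ℝ :=
  if c < phat then
    p * (Real.log phat - Real.log c) / (-Real.log c)
      + (1 - p) * (Real.log (1 - phat) - Real.log (1 - c)) / (-Real.log c)
  else 0

/-- Gibbs' inequality for two Bernoulli distributions: the expected logarithmic score is
uniquely maximized by the true probability. -/
theorem bernoulli_log_score_lt {p q : ℝ} (hp : p ∈ Set.Ioo (0:ℝ) 1) (hq : q ∈ Set.Ioo (0:ℝ) 1)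
    (hne : q ≠ p) :
    p * Real.log q + (1 - p) * Real.log (1 - q)
      < p * Real.log p + (1 - p) * Real.log (1 - p) := by
  obtain ⟨hp0, hp1⟩ := hp
  obtain ⟨hq0, hq1⟩ := hq
  have hp1' : 0 < 1 - p := sub_pos.2 hp1
  have hq1' : 0 < 1 - q := sub_pos.2 hq1
  have h₁ : p * (Real.log q - Real.log p) < q - p := by
    have h := Real.log_lt_sub_one_of_pos (div_pos hq0 hp0)
      (fun h => hne ((div_eq_one_iff_eq hp0.ne').1 h))
    rw [Real.log_div hq0.ne' hp0.ne'] at h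
    calc p * (Real.log q - Real.log p) < p * (q / p - 1) := mul_lt_mul_of_pos_left h hp0
      _ = q - p := by field_simp
  have h₂ : (1 - p) * (Real.log (1 - q) - Real.log (1 - p)) ≤ p - q := by
    have h := Real.log_le_sub_one_of_pos (div_pos hq1' hp1')
    rw [Real.log_div hq1'.ne' hp1'.ne'] at h
    calc (1 - p) * (Real.log (1 - q) - Real.log (1 - p))
        ≤ (1 - p) * ((1 - q) / (1 - p) - 1) := mul_le_mul_of_nonneg_left h hp1'.le
      _ = p - q := by field_simp; ring
  linarith

/-- Above the lending threshold, the truncated Winkler elicitation mechanism is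
strictly proper: for every belief `p ∈ (c,1)` and every report `phat ∈ [0,1)` with
`phat ≠ p`, truthful reporting gives strictly higher expected utility. -/
theorem stmt_0 (c : ℝ) (hc : c ∈ Set.Ioo (0:ℝ) 1)
    (p : ℝ) (hp : p ∈ Set.Ioo c 1)
    (phat : ℝ) (hphat : phat ∈ Set.Ico (0:ℝ) 1) (hne : phat ≠ p) :
    truncWinklerU c p phat < truncWinklerU c p p := by
  obtain ⟨hc0, hc1⟩ := hc
  obtain ⟨hcp, hp1⟩ := hp
  have hp : p ∈ Set.Ioo (0:ℝ) 1 := ⟨hc0.trans hcp, hp1⟩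
  have hlog : 0 < -Real.log c := neg_pos.2 (Real.log_neg hc0 hc1)
  unfold truncWinklerU
  simp only [if_pos hcp, ← add_div]
  split_ifs with hlt
  · have h := bernoulli_log_score_lt hp ⟨hc0.trans hlt, hphat.2⟩ hne
    exact div_lt_div_of_pos_right (by linarith) hlog
  · have h := bernoulli_log_score_lt hp ⟨hc0, hc1⟩ hcp.ne
    refine div_pos ?_ hlog
    linarith
end

section
/- Fix a lending threshold c ∈ (0,1). With U(p, p̂) = p·(ln p̂ − ln c)/(−ln c) + (1−p)·(ln(1−p̂) − ln(1−c))/(−ln c) for p̂ > c and U(p, p̂) = 0 for p̂ ≤ c: for every belief p ∈ [0,1) and every report p̂ ∈ [0,1), one has U(p, p) ≥ U(p, p̂) (properness for all beliefs), and U(p, p) ≥ 0 (ex post individual rationality of the truncated Winkler elicitation mechanism for one recommender and one borrower). -/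
/-- The Gibbs inequality for a single outcome. -/
theorem mul_log_sub_log_le_sub {x y : ℝ} (hx : 0 < x) (hy : 0 < y) :
    x * (Real.log y - Real.log x) ≤ y - x := by
  rw [← Real.log_div hy.ne' hx.ne']
  calc x * Real.log (y / x) ≤ x * (y / x - 1) :=
        mul_le_mul_of_nonneg_left (Real.log_le_sub_one_of_pos (div_pos hy hx)) hx.le
    _ = y - x := by field_simp

/-- The Gibbs inequality for two Bernoulli distributions. -/
theorem binary_gibbs {x y : ℝ} (hx : x ∈ Set.Ioo (0 : ℝ) 1) (hy : y ∈ Set.Ioo (0 : ℝ) 1) :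
    x * (Real.log y - Real.log x) + (1 - x) * (Real.log (1 - y) - Real.log (1 - x)) ≤ 0 := by
  have h₁ := mul_log_sub_log_le_sub hx.1 hy.1
  have h₂ := mul_log_sub_log_le_sub (sub_pos.2 hx.2) (sub_pos.2 hy.2)
  linarith

/-- The truncated Winkler elicitation mechanism (one recommender, one borrower) is
proper for all beliefs and ex post individually rational: for every belief
`p ∈ [0,1)` and every report `phat ∈ [0,1)`, truthful reporting gives weakly
larger expected utility and the truthful expected utility is non-negative. -/
theorem stmt_1 (c : ℝ) (hc : c ∈ Set.Ioo (0:ℝ) 1)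
    (p : ℝ) (hp : p ∈ Set.Ico (0:ℝ) 1)
    (phat : ℝ) (hphat : phat ∈ Set.Ico (0:ℝ) 1) :
    truncWinklerU c p phat ≤ truncWinklerU c p p ∧ 0 ≤ truncWinklerU c p p := by
  obtain ⟨hc0, hc1⟩ := hc
  have hlog : 0 < -Real.log c := neg_pos.2 (Real.log_neg hc0 hc1)
  have hnonneg : 0 ≤ truncWinklerU c p p := by
    unfold truncWinklerU
    split_ifs with h
    · rw [← add_div]
      refine div_nonneg ?_ hlog.le
      linarith [binary_gibbs ⟨hc0.trans h, hp.2⟩ ⟨hc0, hc1⟩]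
    · exact le_rfl
  refine ⟨?_, hnonneg⟩
  by_cases hq : c < phat
  · have hq' : phat ∈ Set.Ioo (0 : ℝ) 1 := ⟨hc0.trans hq, hphat.2⟩
    unfold truncWinklerU
    rw [if_pos hq, ← add_div]
    split_ifs with h
    · rw [← add_div]
      refine div_le_div_of_nonneg_right ?_ hlog.le
      linarith [binary_gibbs ⟨hc0.trans h, hp.2⟩ hq']
    · refine div_nonpos_of_nonpos_of_nonneg ?_ hlog.le
      -- The utility from reporting `phat` is increasing in the belief and nonpositive at `c`.
      have hgibbs := binary_gibbs ⟨hc0, hc1⟩ hq'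
      have hrepay : Real.log c < Real.log phat := Real.log_lt_log hc0 hq
      have hdefault : Real.log (1 - phat) < Real.log (1 - c) :=
        Real.log_lt_log (sub_pos.2 hphat.2) (by linarith)
      nlinarith [mul_nonneg (sub_nonneg.2 (not_lt.1 h)) (sub_nonneg.2 hrepay.le),
        mul_nonneg (sub_nonneg.2 (not_lt.1 h)) (sub_nonneg.2 hdefault.le)]
  · have hzero : truncWinklerU c p phat = 0 := if_neg hq
    rwa [hzero]
end

section
/- Fix a lending threshold c with 1/2 ≤ c < 1. Define the expected utility of the truncated quadratic mechanism with compensation payment by U(p, p̂) = 2·(p·p̂ + (1−p)·(1−p̂)) − p̂² − (1−p̂)² when p̂ > c, and U(p, p̂) = c² + (1−c)² when p̂ ≤ c. Then for all p, p̂ ∈ [0,1], U(p, p) ≥ U(p, p̂); i.e., when c ≥ 1/2 this mechanism is proper. -/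
/-- Expected utility of the truncated quadratic mechanism with compensation payment:
if the report `phat` exceeds the threshold `c`, the expected quadratic (Brier) score
`2(p·phat + (1−p)(1−phat)) − phat² − (1−phat)²`; otherwise the compensation
`c² + (1−c)²`. -/
noncomputable def truncQuadU (c p phat : ℝ) : ℝ :=
  if c < phat then 2 * (p * phat + (1 - p) * (1 - phat)) - phat ^ 2 - (1 - phat) ^ 2
  else c ^ 2 + (1 - c) ^ 2

/-- For a lending threshold `c` with `1/2 ≤ c < 1`, the truncated quadratic mechanism
with compensation payment is proper: truthful reporting weakly maximizes expected
utility for all beliefs and reports in `[0,1]`. -/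
theorem stmt_3 (c : ℝ) (hc : 1/2 ≤ c) (hc1 : c < 1)
    (p : ℝ) (hp : p ∈ Set.Icc (0:ℝ) 1)
    (phat : ℝ) (hphat : phat ∈ Set.Icc (0:ℝ) 1) :
    truncQuadU c p phat ≤ truncQuadU c p p := by
  unfold truncQuadU
  split_ifs with hcphat hcp hcp
  · nlinarith [sq_nonneg (p - phat)]
  · have hpc : 0 ≤ (c - p) * (2 * phat - 1) :=
      mul_nonneg (by linarith) (by linarith)
    nlinarith [sq_nonneg (c - phat)]
  · have hpc : 0 ≤ (p - c) * (p + c - 1) :=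
      mul_nonneg (by linarith) (by linarith)
    nlinarith
  · exact le_rfl
end

section
/- Fix a lending threshold c with 0 < c < 1/2, and define U(p, p̂) = 2·(p·p̂ + (1−p)·(1−p̂)) − p̂² − (1−p̂)² when p̂ > c, and U(p, p̂) = c² + (1−c)² when p̂ ≤ c. Then for every belief p ∈ (c, 1−c) and every report p̂ ≤ c, one has U(p, p̂) = c² + (1−c)² > p² + (1−p)² = U(p, p); hence when c < 1/2 the truncated quadratic mechanism with compensation payment is not proper: any recommender with belief strictly between c and 1−c strictly profits by reporting at or below the threshold. -/
/-- For a lending threshold `c < 1/2`, the truncated quadratic mechanism with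
compensation payment is not proper: any recommender with belief `p` strictly between
`c` and `1 − c` strictly profits from any report at or below the threshold, since
`U(p,phat) = c² + (1−c)² > p² + (1−p)² = U(p,p)`. -/
theorem stmt_4 (c : ℝ) (hc0 : 0 < c) (hc : c < 1/2)
    (p : ℝ) (hp : p ∈ Set.Ioo c (1 - c))
    (phat : ℝ) (hphat : phat ≤ c) :
    truncQuadU c p phat = c ^ 2 + (1 - c) ^ 2 ∧
    p ^ 2 + (1 - p) ^ 2 < c ^ 2 + (1 - c) ^ 2 ∧
    truncQuadU c p p = p ^ 2 + (1 - p) ^ 2 := by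
  obtain ⟨hcp, hpc⟩ := hp
  refine ⟨if_neg hphat.not_gt, ?_, ?_⟩
  · nlinarith [mul_pos (sub_pos.2 hcp) (sub_pos.2 hpc)]
  · rw [truncQuadU, if_pos hcp]
    ring
end

section
/- Consider the truncated Winkler mechanism with n recommenders, m borrowers, unconstrained liquidity, threshold c ∈ (0,1), and aggregators B_q: [0,1]^n → ℝ that are weakly increasing in each coordinate. Fix a recommender i, reports p̂_{-i} of the others, and a borrower q, and suppose the threshold c_{iq} = inf{ p' ∈ [0,1] : B_q(p', p̂_{-i,q}) > c } satisfies 0 < c_{iq} < 1. Let the per-borrower expected utility of recommender i with belief p_{iq} ∈ [0,1) and report p̂_{iq} ∈ [0,1) be u(p_{iq}, p̂_{iq}) = p_{iq}·(ln p̂_{iq} − ln c_{iq})/(−ln c_{iq}) + (1−p_{iq})·(ln(1−p̂_{iq}) − ln(1−c_{iq}))/(−ln c_{iq}) if B_q(p̂_{iq}, p̂_{-i,q}) > c, and 0 otherwise. Then: (a) u(p_{iq}, p_{iq}) ≥ u(p_{iq}, p̂_{iq}) for every p̂_{iq} (ex post properness); (b) if p_{iq} > c_{iq}, then u(p_{iq},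 p_{iq}) > u(p_{iq}, p̂_{iq}) for every p̂_{iq} ≠ p_{iq} (strict ex post properness); and (c) u(p_{iq}, p_{iq}) ≥ 0 (ex post individual rationality). -/
/-- Strict Gibbs inequality for Bernoulli distributions. -/
theorem bernoulli_gibbs_lt {p x : ℝ} (hp0 : 0 ≤ p) (hp1 : p < 1) (hx0 : 0 < x) (hx1 : x < 1)
    (hne : x ≠ p) :
    p * Real.log x + (1 - p) * Real.log (1 - x) < p * Real.log p + (1 - p) * Real.log (1 - p) := by
  have hq : 0 < 1 - p := by linarith
  have hy : 0 < 1 - x := by linarith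
  have h2 : (1 - p) * (Real.log (1 - x) - Real.log (1 - p)) < p - x := by
    have hlt := Real.log_lt_sub_one_of_pos (div_pos hy hq) (by
      rw [Ne, div_eq_one_iff_eq hq.ne']
      exact fun h => hne (by linarith))
    rw [Real.log_div hy.ne' hq.ne'] at hlt
    calc _ < (1 - p) * ((1 - x) / (1 - p) - 1) := mul_lt_mul_of_pos_left hlt hq
      _ = p - x := by field_simp; ring
  have h1 : p * (Real.log x - Real.log p) ≤ x - p := by
    rcases hp0.eq_or_lt with rfl | hp
    · simpa using hx0.le
    · have hle := Real.log_le_sub_one_of_pos (div_pos hx0 hp)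
      rw [Real.log_div hx0.ne' hp.ne'] at hle
      calc _ ≤ p * (x / p - 1) := mul_le_mul_of_nonneg_left hle hp0
        _ = x - p := by field_simp
  linarith

/-- Gibbs inequality for Bernoulli distributions. -/
theorem bernoulli_gibbs_le {p x : ℝ} (hp0 : 0 ≤ p) (hp1 : p < 1) (hx0 : 0 < x) (hx1 : x < 1) :
    p * Real.log x + (1 - p) * Real.log (1 - x) ≤ p * Real.log p + (1 - p) * Real.log (1 - p) := by
  rcases eq_or_ne x p with rfl | h
  · exact le_rfl
  · exact (bernoulli_gibbs_lt hp0 hp1 hx0 hx1 h).le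

/-- If the belief `p` is at most the parameter `t` and the report `x` at least `t`, the expected
logarithmic score of `x` relative to `t` is nonpositive. -/
theorem log_score_nonpos {p t x : ℝ} (hpt : p ≤ t) (ht0 : 0 < t) (htx : t ≤ x) (hx1 : x < 1) :
    p * (Real.log x - Real.log t) + (1 - p) * (Real.log (1 - x) - Real.log (1 - t)) ≤ 0 := by
  have h1 : Real.log t ≤ Real.log x := Real.log_le_log ht0 htx
  have h2 : Real.log (1 - x) ≤ Real.log (1 - t) := Real.log_le_log (by linarith) (by linarith)
  have h3 := bernoulli_gibbs_le ht0.le (htx.trans_lt hx1) (ht0.trans_le htx) hx1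
  nlinarith [mul_nonneg (sub_nonneg.2 hpt)
    (by linarith : 0 ≤ (Real.log x - Real.log t) - (Real.log (1 - x) - Real.log (1 - t)))]


/-- Truncated Winkler mechanism with `n` recommenders and `m` borrowers,
unconstrained liquidity, threshold `c ∈ (0,1)`, and coordinatewise weakly increasing
aggregators `B q`.  Fix a recommender `i`, reports `r` of the others (the `i`-th
coordinate of `r` is irrelevant since it is always overwritten), and a borrower `q`;
suppose the induced threshold `ciq ∈ (0,1)`.  The per-borrower expected utility of
recommender `i` with belief `p` and report `phat` is the expected logarithmic-based
Winkler score with parameter `ciq` if the aggregate of the reports exceeds `c`, and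
`0` otherwise.  Then the mechanism is (a) ex post proper, (b) strictly ex post proper
when `p > ciq`, and (c) ex post individually rational. -/
theorem stmt_6 (n m : ℕ) (B : Fin m → (Fin n → ℝ) → ℝ)
    (hBmono : ∀ q, Monotone (B q))
    (c : ℝ) (hc : c ∈ Set.Ioo (0:ℝ) 1)
    (i : Fin n) (q : Fin m)
    (r : Fin n → ℝ) (hr : ∀ j, r j ∈ Set.Icc (0:ℝ) 1)
    (ciq : ℝ)
    (hciq : ciq = sInf {p' : ℝ | p' ∈ Set.Icc (0:ℝ) 1 ∧ c < B q (Function.update r i p')})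
    (hciq0 : 0 < ciq) (hciq1 : ciq < 1)
    (u : ℝ → ℝ → ℝ)
    (hu : ∀ p phat : ℝ, u p phat =
      if c < B q (Function.update r i phat) then
        p * (Real.log phat - Real.log ciq) / (-Real.log ciq)
          + (1 - p) * (Real.log (1 - phat) - Real.log (1 - ciq)) / (-Real.log ciq)
      else 0) :
    (∀ p ∈ Set.Ico (0:ℝ) 1, ∀ phat ∈ Set.Ico (0:ℝ) 1, u p phat ≤ u p p) ∧
    (∀ p ∈ Set.Ico (0:ℝ) 1, ciq < p →
      ∀ phat ∈ Set.Ico (0:ℝ) 1, phat ≠ p → u p phat < u p p) ∧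
    (∀ p ∈ Set.Ico (0:ℝ) 1, 0 ≤ u p p) := by
  have hL : 0 < -Real.log ciq := neg_pos.2 (Real.log_neg hciq0 hciq1)
  have hge : ∀ x ∈ Set.Ico (0:ℝ) 1, c < B q (Function.update r i x) → ciq ≤ x := by
    intro x hx hB
    rw [hciq]
    exact csInf_le ⟨0, fun y hy => hy.1.1⟩ ⟨⟨hx.1, hx.2.le⟩, hB⟩
  have halloc : ∀ x, ciq < x → c < B q (Function.update r i x) := by
    intro x hx
    have hne : {p' : ℝ | p' ∈ Set.Icc (0:ℝ) 1 ∧ c < B q (Function.update r i p')}.Nonempty := by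
      by_contra h
      rw [Set.not_nonempty_iff_eq_empty.1 h, Real.sInf_empty] at hciq
      exact hciq0.ne' hciq
    rw [hciq] at hx
    obtain ⟨y, hy, hyx⟩ := exists_lt_of_csInf_lt hne hx
    exact hy.2.trans_le (hBmono q (update_le_update_iff.2 ⟨hyx.le, fun _ _ => le_rfl⟩))
  have hu' : ∀ p x, c < B q (Function.update r i x) →
      u p x = (p * (Real.log x - Real.log ciq)
        + (1 - p) * (Real.log (1 - x) - Real.log (1 - ciq))) / (-Real.log ciq) := by
    intro p x h
    rw [hu, if_pos h, ← add_div]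
  have hu0 : ∀ p x, ¬ c < B q (Function.update r i x) → u p x = 0 := by
    intro p x h
    rw [hu, if_neg h]
  have hIR : ∀ p ∈ Set.Ico (0:ℝ) 1, 0 ≤ u p p := by
    intro p hp
    by_cases h : c < B q (Function.update r i p)
    · rw [hu' p p h]
      refine div_nonneg ?_ hL.le
      linarith [bernoulli_gibbs_le hp.1 hp.2 hciq0 hciq1]
    · exact (hu0 p p h).ge
  refine ⟨fun p hp x hx => ?_, fun p hp hlt x hx hne => ?_, hIR⟩
  · by_cases h : c < B q (Function.update r i x)
    · have hcx := hge x hx h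
      by_cases h' : c < B q (Function.update r i p)
      · rw [hu' p x h, hu' p p h']
        refine div_le_div_of_nonneg_right ?_ hL.le
        linarith [bernoulli_gibbs_le hp.1 hp.2 (hciq0.trans_le hcx) hx.2]
      · rw [hu' p x h, hu0 p p h']
        exact div_nonpos_of_nonpos_of_nonneg
          (log_score_nonpos (not_lt.1 (mt (halloc p) h')) hciq0 hcx hx.2) hL.le
    · rw [hu0 p x h]
      exact hIR p hp
  · have h' := halloc p hlt
    by_cases h : c < B q (Function.update r i x)
    · rw [hu' p x h, hu' p p h']
      refine div_lt_div_of_pos_right ?_ hL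
      linarith [bernoulli_gibbs_lt hp.1 hp.2 (hciq0.trans_le (hge x hx h)) hx.2 hne]
    · rw [hu0 p x h, hu' p p h']
      refine div_pos ?_ hL
      linarith [bernoulli_gibbs_lt hp.1 hp.2 hciq0 hciq1 hlt.ne]
end

section
/- Consider the truncated Winkler mechanism built from a bounded strictly proper scoring rule s, with n ≥ 2 recommenders, m borrowers, unconstrained liquidity, threshold c ∈ (0,1), and Borel-measurable aggregators B_q: [0,1]^n → ℝ that are weakly increasing in each coordinate. Let μ be a Borel probability measure on the space ([0,1]^m)^n of belief profiles p = (p_1, …, p_n) satisfying the grain of no veto condition at c: for every recommender i and borrower q, μ{ p : B_q(0, p_{-i,q}) > c } > 0. Then the mechanism is strictly interim incentive compatible: for every recommender i, every belief p_i ∈ [0,1]^m, and every report p̂_i ≠ p_i, the expected utility of i over p_{-i} drawn from the conditional/marginal law of μ with the other recommenders truthful satisfies E_{p_{-i}}[U_i(p_i, p_i, p_{-i})] > E_{p_{-i}}[U_i(p_i, p̂_i, p_{-i})]; moreover U_i(p_i, p_i, p̂_{-i}) ≥ 0 for all p̂_{-i} (ex post individual rationality). -/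
open MeasureTheory

/-- Expected score of the report `r` under the belief `p`. -/
def expectedScore (s : ℝ → Bool → ℝ) (p r : ℝ) : ℝ :=
  p * s r true + (1 - p) * s r false

/-- Strict propriety of a scoring rule for binary outcomes. -/
def StrictlyProper (s : ℝ → Bool → ℝ) : Prop :=
  ∀ p ∈ Set.Icc (0 : ℝ) 1, ∀ r ∈ Set.Icc (0 : ℝ) 1, r ≠ p →
    expectedScore s p r < expectedScore s p p

/-- The infimum of the reports in `[0, 1]` at which `f` exceeds `c`, or `1` if there are none. -/
noncomputable def criticalReport (c : ℝ) (f : ℝ → ℝ) : ℝ :=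
  sInf (insert (1 : ℝ) {x : ℝ | x ∈ Set.Icc (0 : ℝ) 1 ∧ c < f x})

/-- The Winkler normalization of `s` at `t`, with value `0` at `t = 1`. -/
noncomputable def winklerScore (s : ℝ → Bool → ℝ) (t r : ℝ) (o : Bool) : ℝ :=
  if t = 1 then 0 else (s r o - s t o) / (s 1 true - s t true)

/-- Expected truncated Winkler payment for a single borrower, where `f` is the aggregate as a
function of the recommender's own report. -/
noncomputable def winklerUtility (s : ℝ → Bool → ℝ) (c : ℝ) (f : ℝ → ℝ) (p r : ℝ) : ℝ :=
  if c < f r then expectedScore (winklerScore s (criticalReport c f)) p r else 0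

theorem expectedScore_winklerScore_one (s : ℝ → Bool → ℝ) (p r : ℝ) :
    expectedScore (winklerScore s 1) p r = 0 := by
  simp [expectedScore, winklerScore]

theorem expectedScore_winklerScore {t : ℝ} (s : ℝ → Bool → ℝ) (ht : t ≠ 1) (p r : ℝ) :
    expectedScore (winklerScore s t) p r =
      (expectedScore s p r - expectedScore s p t) / (s 1 true - s t true) := by
  simp only [expectedScore, winklerScore, if_neg ht]
  ring

section criticalReport

variable {c : ℝ} {f : ℝ → ℝ}

theorem bddBelow_insert_one :
    BddBelow (insert (1 : ℝ) {x : ℝ | x ∈ Set.Icc (0 : ℝ) 1 ∧ c < f x}) :=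
  ⟨0, by rintro x (rfl | hx); exacts [zero_le_one, hx.1.1]⟩

theorem criticalReport_mem_Icc (c : ℝ) (f : ℝ → ℝ) : criticalReport c f ∈ Set.Icc (0 : ℝ) 1 :=
  ⟨le_csInf ⟨1, Set.mem_insert _ _⟩ (by rintro x (rfl | hx); exacts [zero_le_one, hx.1.1]),
    csInf_le bddBelow_insert_one (Set.mem_insert _ _)⟩

theorem criticalReport_le {r : ℝ} (hr : r ∈ Set.Icc (0 : ℝ) 1) (h : c < f r) :
    criticalReport c f ≤ r :=
  csInf_le bddBelow_insert_one (Set.mem_insert_of_mem _ ⟨hr, h⟩)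

theorem criticalReport_eq_zero (h : c < f 0) : criticalReport c f = 0 :=
  le_antisymm (criticalReport_le ⟨le_rfl, zero_le_one⟩ h) (criticalReport_mem_Icc c f).1

theorem lt_of_criticalReport_lt (hf : Monotone f) {r : ℝ} (hr : r ≤ 1)
    (h : criticalReport c f < r) : c < f r := by
  obtain ⟨x, rfl | hx, hxr⟩ := exists_lt_of_csInf_lt ⟨1, Set.mem_insert _ _⟩ h
  · exact absurd hxr hr.not_gt
  · exact hx.2.trans_le (hf hxr.le)

end criticalReport

namespace StrictlyProper

variable {s : ℝ → Bool → ℝ} {c : ℝ} {f : ℝ → ℝ} {p r t : ℝ}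

theorem expectedScore_le (hs : StrictlyProper s) (hp : p ∈ Set.Icc (0 : ℝ) 1)
    (hr : r ∈ Set.Icc (0 : ℝ) 1) : expectedScore s p r ≤ expectedScore s p p := by
  rcases eq_or_ne r p with rfl | h
  · exact le_rfl
  · exact (hs p hp r hr h).le

theorem score_one_pos (hs : StrictlyProper s) (ht : t ∈ Set.Icc (0 : ℝ) 1) (h : t ≠ 1) :
    0 < s 1 true - s t true := by
  have := hs 1 ⟨zero_le_one, le_rfl⟩ t ht h
  simpa [expectedScore] using this

/-- Above the true belief, the expected score decreases with the report. -/
theorem expectedScore_antitone (hs : StrictlyProper s) (ht : t ∈ Set.Icc (0 : ℝ) 1)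
    (hr : r ∈ Set.Icc (0 : ℝ) 1) (hpt : p ≤ t) (htr : t ≤ r) :
    expectedScore s p r ≤ expectedScore s p t := by
  rcases htr.eq_or_lt with rfl | htr
  · exact le_rfl
  have h₁ := hs t ht r hr htr.ne'
  have h₂ := hs r hr t ht htr.ne
  unfold expectedScore at *
  have h₃ : 0 ≤ (s r true - s r false) - (s t true - s t false) := by
    by_contra! h
    nlinarith
  nlinarith

theorem winklerUtility_self_nonneg (hs : StrictlyProper s) (hp : p ∈ Set.Icc (0 : ℝ) 1) :
    0 ≤ winklerUtility s c f p p := by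
  have ht := criticalReport_mem_Icc c f
  unfold winklerUtility
  split_ifs
  · by_cases h : criticalReport c f = 1
    · rw [h, expectedScore_winklerScore_one]
    · rw [expectedScore_winklerScore s h]
      exact div_nonneg (sub_nonneg.2 (hs.expectedScore_le hp ht)) (hs.score_one_pos ht h).le
  · exact le_rfl

theorem winklerUtility_le (hs : StrictlyProper s) (hf : Monotone f)
    (hp : p ∈ Set.Icc (0 : ℝ) 1) (hr : r ∈ Set.Icc (0 : ℝ) 1) :
    winklerUtility s c f p r ≤ winklerUtility s c f p p := by
  by_cases hcr : c < f r
  swap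
  · rw [winklerUtility, if_neg hcr]
    exact hs.winklerUtility_self_nonneg hp
  have ht := criticalReport_mem_Icc c f
  by_cases h : criticalReport c f = 1
  · simp [winklerUtility, h, expectedScore_winklerScore_one]
  have hD := (hs.score_one_pos ht h).le
  by_cases hcp : c < f p
  · rw [winklerUtility, winklerUtility, if_pos hcr, if_pos hcp, expectedScore_winklerScore s h,
      expectedScore_winklerScore s h]
    exact div_le_div_of_nonneg_right (sub_le_sub_right (hs.expectedScore_le hp hr) _) hD
  · rw [winklerUtility, winklerUtility, if_pos hcr, if_neg hcp, expectedScore_winklerScore s h]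
    exact div_nonpos_of_nonpos_of_nonneg (sub_nonpos.2 (hs.expectedScore_antitone ht hr
      (le_of_not_gt fun h' => hcp (lt_of_criticalReport_lt hf hp.2 h'))
      (criticalReport_le hr hcr))) hD

/-- Misreporting is strictly costly when the recommender cannot veto the loan. -/
theorem winklerUtility_lt (hs : StrictlyProper s) (hf : Monotone f) (h₀ : c < f 0)
    (hp : p ∈ Set.Icc (0 : ℝ) 1) (hr : r ∈ Set.Icc (0 : ℝ) 1) (hrp : r ≠ p) :
    winklerUtility s c f p r < winklerUtility s c f p p := by
  have h : criticalReport c f ≠ 1 := by simp [criticalReport_eq_zero h₀]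
  rw [winklerUtility, winklerUtility, if_pos (h₀.trans_le (hf hr.1)),
    if_pos (h₀.trans_le (hf hp.1)), expectedScore_winklerScore s h,
    expectedScore_winklerScore s h]
  exact div_lt_div_of_pos_right (sub_lt_sub_right (hs p hp r hr hrp) _)
    (hs.score_one_pos (criticalReport_mem_Icc c f) h)

end StrictlyProper

theorem integral_lt_integral_of_le_of_lt_on {α : Type*} [MeasurableSpace α] {μ : Measure α}
    {f g : α → ℝ} (hf : Integrable f μ) (hg : Integrable g μ) (hle : ∀ x, f x ≤ g x)
    {A : Set α} (hA : 0 < μ A) (hlt : ∀ x ∈ A, f x < g x) :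
    ∫ x, f x ∂μ < ∫ x, g x ∂μ := by
  rw [← sub_pos, ← integral_sub hg hf]
  refine (integral_pos_iff_support_of_nonneg (fun x => sub_nonneg.2 (hle x)) (hg.sub hf)).2
    (hA.trans_le (measure_mono fun x hx => ?_))
  exact (sub_pos.2 (hlt x hx)).ne'

/-- Truncated Winkler mechanism built from a bounded strictly proper scoring rule `s`,
with `n ≥ 2` recommenders, `m` borrowers, unconstrained liquidity, threshold
`c ∈ (0,1)`, and Borel-measurable, coordinatewise weakly increasing aggregators `B q`.
`sW c'` is the Winkler normalization of `s` with parameter `c'` (score `0` by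
convention when `c' = 1`); `ciq i R q` is the threshold report of recommender `i` on
borrower `q` given the report profile `R` (equal to `1` when no report triggers a
loan, via the inserted element); `U i pi phati P` is the expected utility of
recommender `i` with beliefs `pi` and own report `phati` when the others report `P`.
If the prior `μ` on belief profiles in `([0,1]^m)^n` satisfies the grain of no veto
condition at `c`, then (with the others truthful, and integrability assumed so that
all expectations exist) the mechanism is strictly interim incentive compatible, and
it is ex post individually rational. -/
theorem stmt_7 (n m : ℕ) (hn : 2 ≤ n)
    (c : ℝ) (hc : c ∈ Set.Ioo (0:ℝ) 1)
    (B : Fin m → (Fin n → ℝ) → ℝ)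
    (hBmono : ∀ q, Monotone (B q))
    (hBmeas : ∀ q, Measurable (B q))
    (s : ℝ → Bool → ℝ)
    (hs_bdd : ∃ M : ℝ, ∀ p ∈ Set.Icc (0:ℝ) 1, ∀ o : Bool, |s p o| ≤ M)
    (hs_proper : ∀ p ∈ Set.Icc (0:ℝ) 1, ∀ r ∈ Set.Icc (0:ℝ) 1, r ≠ p →
      p * s r true + (1 - p) * s r false < p * s p true + (1 - p) * s p false)
    (sW : ℝ → ℝ → Bool → ℝ)
    (hsW : ∀ c' phat o, sW c' phat o =
      if c' = 1 then 0 else (s phat o - s c' o) / (s 1 true - s c' true))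
    (ciq : Fin n → (Fin n → Fin m → ℝ) → Fin m → ℝ)
    (hciq : ∀ i R q, ciq i R q =
      sInf (insert (1:ℝ)
        {p' : ℝ | p' ∈ Set.Icc (0:ℝ) 1 ∧ c < B q (Function.update (fun j => R j q) i p')}))
    (U : Fin n → (Fin m → ℝ) → (Fin m → ℝ) → (Fin n → Fin m → ℝ) → ℝ)
    (hU : ∀ i pi phati P, U i pi phati P =
      ∑ q, (if c < B q (fun j => Function.update P i phati j q) then
          pi q * sW (ciq i (Function.update P i phati) q) (phati q) true
            + (1 - pi q) * sW (ciq i (Function.update P i phati) q) (phati q) false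
        else 0))
    (μ : Measure (Fin n → Fin m → Set.Icc (0:ℝ) 1)) [IsProbabilityMeasure μ]
    (hveto : ∀ (i : Fin n) (q : Fin m),
      0 < μ {P | c < B q (Function.update (fun j => (P j q : ℝ)) i 0)})
    (hint : ∀ (i : Fin n) (pi phati : Fin m → ℝ),
      Integrable (fun P : Fin n → Fin m → Set.Icc (0:ℝ) 1 =>
        U i pi phati (fun j q => (P j q : ℝ))) μ) :
    (∀ (i : Fin n) (pi : Fin m → ℝ), (∀ q, pi q ∈ Set.Icc (0:ℝ) 1) →
      ∀ phati : Fin m → ℝ, (∀ q, phati q ∈ Set.Icc (0:ℝ) 1) → phati ≠ pi →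
      ∫ P, U i pi phati (fun j q => (P j q : ℝ)) ∂μ
        < ∫ P, U i pi pi (fun j q => (P j q : ℝ)) ∂μ) ∧
    (∀ (i : Fin n) (pi : Fin m → ℝ), (∀ q, pi q ∈ Set.Icc (0:ℝ) 1) →
      ∀ R : Fin n → Fin m → ℝ, (∀ j q, R j q ∈ Set.Icc (0:ℝ) 1) →
      0 ≤ U i pi pi R) := by
  have hs : StrictlyProper s := hs_proper
  have hmono : ∀ (i : Fin n) (q : Fin m) (v : Fin n → ℝ),
      Monotone fun x => B q (Function.update v i x) :=
    fun _ q _ => (hBmono q).comp Function.update_mono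
  have hU' : ∀ i p r P, U i p r P = ∑ q, winklerUtility s c
      (fun x => B q (Function.update (fun j => P j q) i x)) (p q) (r q) := by
    intro i p r P
    rw [hU]
    refine Finset.sum_congr rfl fun q _ => ?_
    have h : (fun j => Function.update P i r j q) =
        Function.update (fun j => P j q) i (r q) := by
      ext j
      rcases eq_or_ne j i with rfl | hj
      · simp
      · simp [hj]
    simp only [hsW, hciq, h, Function.update_idem]
    rfl
  refine ⟨fun i p hp r hr hrp => ?_, fun i p hp R _ => ?_⟩
  · obtain ⟨q, hq⟩ := Function.ne_iff.1 hrp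
    refine integral_lt_integral_of_le_of_lt_on (hint i p r) (hint i p p) (fun P => ?_)
      (hveto i q) fun P hP => ?_
    · rw [hU', hU']
      exact Finset.sum_le_sum fun k _ => hs.winklerUtility_le (hmono i k _) (hp k) (hr k)
    · rw [hU', hU']
      exact Finset.sum_lt_sum
        (fun k _ => hs.winklerUtility_le (hmono i k _) (hp k) (hr k))
        ⟨q, Finset.mem_univ q, hs.winklerUtility_lt (hmono i q _) hP (hp q) (hr q) hq⟩
  · rw [hU']
    exact Finset.sum_nonneg fun q _ => hs.winklerUtility_self_nonneg (hp q)
end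

section
/- Consider the VCG scoring mechanism without a reserve (threshold c = 0), with n ≥ 3 recommenders, m ≥ 2 borrowers, liquidity constraint 1 ≤ K < m, weights w_1,…,w_n > 0 summing to 1 with max_i w_i < 1/2, and a measurable selection x(·) of value-maximizing feasible allocations. Let μ be a Borel probability measure on ([0,1]^m)^{n−1} with full support (every nonempty open set has positive measure), describing the beliefs of the other recommenders, who report truthfully. Then for every recommender i, every belief p_i ∈ [0,1]^m, and every report p̂_i ≠ p_i that is not an equal-shift misreport (i.e., there exist borrowers q, q' with p_{iq} − p_{iq'} ≠ p̂_{iq} − p̂_{iq'}), one has E_{p_{-i}∼μ}[U_i(p_i, p_i, p_{-i})] > E_{p_{-i}∼μ}[U_i(p_i, p̂_i, p_{-i})]. That is, the mechanism is strictly interim incentive compatible up to equal-shift misreports. -/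
open MeasureTheory

/-- Combine recommender `i`'s report `ri` with the (truthful) reports `P` of the
other recommenders into a full report profile. -/
noncomputable def combineReports {n m : ℕ} (i : Fin n) (ri : Fin m → ℝ)
    (P : {j : Fin n // j ≠ i} → Fin m → Set.Icc (0:ℝ) 1) : Fin n → Fin m → ℝ :=
  fun j => if h : j = i then ri else fun q => (P ⟨j, h⟩ q : ℝ)

/-- `A` maximizes the additive value `v` among sets of at most `K` elements. -/
def IsBestAllocation {α : Type*} (K : ℕ) (v : α → ℝ) (A : Finset α) : Prop :=
  A.card ≤ K ∧ ∀ a : Finset α, a.card ≤ K → ∑ q ∈ a, v q ≤ ∑ q ∈ A, v q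

section BestAllocation

variable {α : Type*} [DecidableEq α]

lemma sum_insert_erase_eq (v : α → ℝ) {A : Finset α} {r s : α} (hr : r ∉ A) (hs : s ∈ A) :
    ∑ q ∈ insert r (A.erase s), v q = ∑ q ∈ A, v q + v r - v s := by
  rw [Finset.sum_insert (by simp [hr]), ← Finset.add_sum_erase A v hs]
  ring

lemma card_insert_erase_eq {A : Finset α} {r s : α} (hr : r ∉ A) (hs : s ∈ A) :
    (insert r (A.erase s)).card = A.card := by
  rw [Finset.card_insert_of_notMem (by simp [hr]), Finset.card_erase_add_one hs]

lemma IsBestAllocation.le_of_notMem_of_mem {K : ℕ} {v : α → ℝ} {A : Finset α}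
    (hA : IsBestAllocation K v A) {r s : α} (hr : r ∉ A) (hs : s ∈ A) : v r ≤ v s := by
  have h := hA.2 (insert r (A.erase s)) ((card_insert_erase_eq hr hs).trans_le hA.1)
  rw [sum_insert_erase_eq v hr hs] at h
  linarith

lemma IsBestAllocation.card_eq_of_notMem {K : ℕ} {v : α → ℝ} {A : Finset α}
    (hA : IsBestAllocation K v A) {r : α} (hr : r ∉ A) (hpos : 0 < v r) : A.card = K := by
  by_contra hne
  have h := hA.2 (insert r A) (by
    rw [Finset.card_insert_of_notMem hr]
    have := hA.1
    omega)
  rw [Finset.sum_insert hr] at h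
  linarith

/-- If `q'` beats everything outside `H`, and `q` is beaten by `q'` and by the `K - 1` elements of
`H`, then a best allocation contains `q'` but not `q`. -/
lemma IsBestAllocation.notMem_and_mem {K : ℕ} {v : α → ℝ} {A H : Finset α}
    (hA : IsBestAllocation K v A) {q q' : α} (hH : H.card + 1 = K)
    (hq'H : q' ∉ H) (hpos : 0 ≤ v q) (hqq' : v q < v q')
    (hhigh : ∀ h ∈ H, v q < v h)
    (hlow : ∀ l, l ∉ H → l ≠ q → l ≠ q' → v l < v q') : q ∉ A ∧ q' ∈ A := by
  have hq : q ∉ A := by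
    intro hqA
    have hsub : insert q' H ⊆ A.erase q := by
      intro r hr
      have hvr : v q < v r := by
        rcases Finset.mem_insert.mp hr with rfl | hr
        · exact hqq'
        · exact hhigh r hr
      have hrA : r ∈ A := by
        by_contra hrA
        exact absurd (hA.le_of_notMem_of_mem hrA hqA) hvr.not_ge
      refine Finset.mem_erase.mpr ⟨?_, hrA⟩
      rintro rfl
      exact lt_irrefl _ hvr
    have h1 := Finset.card_le_card hsub
    rw [Finset.card_insert_of_notMem hq'H] at h1
    have h2 := Finset.card_erase_add_one hqA
    have := hA.1
    omega
  refine ⟨hq, ?_⟩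
  by_contra hq'
  have hcard := hA.card_eq_of_notMem hq' (hpos.trans_lt hqq')
  have hsub : A ⊆ H := by
    intro l hl
    by_contra hlH
    exact absurd (hA.le_of_notMem_of_mem hq' hl)
      (hlow l hlH (fun h => hq (h ▸ hl)) (fun h => hq' (h ▸ hl))).not_ge
  have := Finset.card_le_card hsub
  omega

end BestAllocation

/-- The reported value that the recommenders other than `i` jointly attach to borrower `q`. -/
noncomputable def othersValue {n m : ℕ} (i : Fin n) (w : Fin n → ℝ)
    (P : {j : Fin n // j ≠ i} → Fin m → Set.Icc (0:ℝ) 1) (q : Fin m) : ℝ :=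
  ∑ j : {j : Fin n // j ≠ i}, w j.1 * (P j q : ℝ)

section othersValue

variable {n m : ℕ} (i : Fin n) (w : Fin n → ℝ)

lemma continuous_othersValue (q : Fin m) : Continuous fun P => othersValue i w P q := by
  unfold othersValue
  fun_prop

lemma sum_combineReports (ri : Fin m → ℝ)
    (P : {j : Fin n // j ≠ i} → Fin m → Set.Icc (0:ℝ) 1) (a : Finset (Fin m)) :
    ∑ j, ∑ q ∈ a, w j * combineReports i ri P j q
      = ∑ q ∈ a, (w i * ri q + othersValue i w P q) := by
  rw [Finset.sum_comm]
  refine Finset.sum_congr rfl fun q _ => ?_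
  rw [Fintype.sum_eq_add_sum_subtype_ne _ i]
  congr 1
  · simp [combineReports]
  · refine Finset.sum_congr rfl fun j _ => ?_
    simp [combineReports, j.2]

lemma othersValue_nonneg (hw : ∀ j, 0 < w j)
    (P : {j : Fin n // j ≠ i} → Fin m → Set.Icc (0:ℝ) 1) (q : Fin m) :
    0 ≤ othersValue i w P q :=
  Finset.sum_nonneg fun j _ => mul_nonneg (hw j).le (P j q).2.1

lemma exists_othersValue_eq (hwsum : ∑ j, w j = 1) (hi : w i < 1) (y : Fin m → ℝ)
    (hy : ∀ q, y q ∈ Set.Icc 0 (1 - w i)) :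
    ∃ P : {j : Fin n // j ≠ i} → Fin m → Set.Icc (0:ℝ) 1, ∀ q, othersValue i w P q = y q := by
  have hW : 0 < 1 - w i := by linarith
  refine ⟨fun _ q => ⟨y q / (1 - w i), div_nonneg (hy q).1 hW.le,
    div_le_one_of_le₀ (hy q).2 hW.le⟩, fun q => ?_⟩
  rw [Fintype.sum_eq_add_sum_subtype_ne _ i] at hwsum
  have hsum : ∑ j : {j : Fin n // j ≠ i}, w j.1 = 1 - w i := by linarith
  simp only [othersValue]
  rw [← Finset.sum_mul, hsum, mul_div_cancel₀ _ hW.ne']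

end othersValue

/-- A pivotal level for the others' value of two borrowers whose gap is `d`. -/
lemma exists_pivotal_level {w a b d : ℝ} (hw : w < 1 / 2)
    (ha : 0 ≤ w * a) (hb : 0 ≤ w * b) (ha1 : w * a ≤ w) (hb1 : w * b ≤ w)
    (hd : w * a - w * b < d) (hdw : d < w) :
    ∃ y, 0 ≤ y ∧ y ≤ 1 - w ∧ 0 ≤ y + d ∧ y + d ≤ 1 - w ∧ w < w * b + (y + d)
      ∧ w * a + y < 1 - w := by
  obtain ⟨y, hy1, hy2⟩ : ∃ y, max 0 (max (-d) (w - d - w * b)) < y ∧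
      y < min (1 - w) (min (1 - w - d) (1 - w - w * a)) := by
    apply exists_between
    simp only [max_lt_iff, lt_min_iff]
    refine ⟨⟨?_, ?_, ?_⟩, ⟨?_, ?_, ?_⟩, ?_, ?_, ?_⟩ <;> linarith
  simp only [max_lt_iff, lt_min_iff] at hy1 hy2
  refine ⟨y, ?_, ?_, ?_, ?_, ?_, ?_⟩ <;> linarith

/-- Strict interim incentive compatibility, up to equal-shift misreports, of the VCG
scoring mechanism without a reserve (`c = 0`): `n ≥ 3` recommenders, `m ≥ 2`
borrowers, liquidity constraint `1 ≤ K < m`, positive weights summing to `1` with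
`max_i w_i < 1/2`, a selection `x` of value-maximizing feasible allocations and a
selection `xmi` of allocations maximizing the others' reported value; the other
recommenders report their beliefs truthfully, drawn from a full-support Borel
probability measure `μ` on `([0,1]^m)^{n−1}`; `U pi ri P` is recommender `i`'s
expected VCG utility (true value of the chosen allocation minus the VCG payment),
and integrability is assumed so the expectations exist.  Then for every belief `pi`
and every misreport `phati ≠ pi` that is not an equal-shift misreport, truthful
reporting has strictly greater expected utility. -/
theorem stmt_12 (n m K : ℕ) (hn : 3 ≤ n) (hm : 2 ≤ m) (hK1 : 1 ≤ K) (hKm : K < m)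
    (w : Fin n → ℝ) (hw : ∀ j, 0 < w j) (hwsum : ∑ j, w j = 1)
    (hmax : ∀ j, w j < 1 / 2)
    (x : (Fin n → Fin m → ℝ) → Finset (Fin m))
    (hx : ∀ R : Fin n → Fin m → ℝ, (x R).card ≤ K ∧
      ∀ a : Finset (Fin m), a.card ≤ K →
        (∑ j, ∑ q ∈ a, w j * R j q) ≤ ∑ j, ∑ q ∈ x R, w j * R j q)
    (i : Fin n)
    (xmi : ({j : Fin n // j ≠ i} → Fin m → Set.Icc (0:ℝ) 1) → Finset (Fin m))
    (hxmi : ∀ P, (xmi P).card ≤ K ∧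
      ∀ a : Finset (Fin m), a.card ≤ K →
        (∑ j : {j : Fin n // j ≠ i}, ∑ q ∈ a, w j.1 * (P j q : ℝ))
        ≤ ∑ j : {j : Fin n // j ≠ i}, ∑ q ∈ xmi P, w j.1 * (P j q : ℝ))
    (μ : Measure ({j : Fin n // j ≠ i} → Fin m → Set.Icc (0:ℝ) 1))
    [IsProbabilityMeasure μ]
    (hfull : ∀ Uo : Set ({j : Fin n // j ≠ i} → Fin m → Set.Icc (0:ℝ) 1),
      IsOpen Uo → Uo.Nonempty → 0 < μ Uo)
    (U : (Fin m → ℝ) → (Fin m → ℝ) →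
      ({j : Fin n // j ≠ i} → Fin m → Set.Icc (0:ℝ) 1) → ℝ)
    (hU : ∀ pi ri P, U pi ri P =
      (∑ q ∈ x (combineReports i ri P), w i * pi q)
      - ((∑ j : {j : Fin n // j ≠ i}, ∑ q ∈ xmi P, w j.1 * (P j q : ℝ))
         - ∑ j : {j : Fin n // j ≠ i}, ∑ q ∈ x (combineReports i ri P), w j.1 * (P j q : ℝ)))
    (hint : ∀ pi ri : Fin m → ℝ, Integrable (U pi ri) μ)
    (pi : Fin m → ℝ) (hpi : ∀ q, pi q ∈ Set.Icc (0:ℝ) 1)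
    (phati : Fin m → ℝ) (hphati : ∀ q, phati q ∈ Set.Icc (0:ℝ) 1)
    (hne : phati ≠ pi)
    (hshift : ∃ q q' : Fin m, pi q - pi q' ≠ phati q - phati q') :
    ∫ P, U pi phati P ∂μ < ∫ P, U pi pi P ∂μ := by
  have hbest : ∀ ri P, IsBestAllocation K (fun q => w i * ri q + othersValue i w P q)
      (x (combineReports i ri P)) := fun ri P => by
    refine ⟨(hx _).1, fun a ha => ?_⟩
    simpa only [sum_combineReports] using (hx (combineReports i ri P)).2 a ha
  have hUeq : ∀ ri P, U pi ri P =
      ∑ q ∈ x (combineReports i ri P), (w i * pi q + othersValue i w P q)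
        - ∑ j : {j : Fin n // j ≠ i}, ∑ q ∈ xmi P, w j.1 * (P j q : ℝ) := fun ri P => by
    rw [hU, Finset.sum_add_distrib]
    simp only [othersValue]
    rw [Finset.sum_comm (s := x (combineReports i ri P))]
    ring
  obtain ⟨q, q', hqq'⟩ : ∃ q q' : Fin m, phati q - phati q' < pi q - pi q' := by
    obtain ⟨q, q', h⟩ := hshift
    rcases lt_or_gt_of_ne h with h | h
    · exact ⟨q', q, by linarith⟩
    · exact ⟨q, q', h⟩
  have hne' : q' ≠ q := by
    rintro rfl
    linarith
  obtain ⟨H, hHsub, hHcard⟩ : ∃ H ⊆ (Finset.univ.erase q).erase q', H.card = K - 1 := by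
    apply Finset.exists_subset_card_eq
    rw [Finset.card_erase_of_mem (by simp [hne']), Finset.card_erase_of_mem (by simp)]
    simp
    omega
  have hqH : q ∉ H := fun h => by simpa using hHsub h
  have hq'H : q' ∉ H := fun h => by simpa using hHsub h
  let O : Set ({j : Fin n // j ≠ i} → Fin m → Set.Icc (0:ℝ) 1) :=
    {P | w i * pi q' + othersValue i w P q' < w i * pi q + othersValue i w P q} ∩
    {P | w i * phati q + othersValue i w P q < w i * phati q' + othersValue i w P q'} ∩
    (⋂ h ∈ H, {P | w i * phati q + othersValue i w P q
      < w i * phati h + othersValue i w P h}) ∩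
    ⋂ l ∈ ((Finset.univ \ H).erase q).erase q',
      {P | w i * phati l + othersValue i w P l < w i * phati q' + othersValue i w P q'}
  have hlt : ∀ (r s : Fin m) (f g : Fin m → ℝ),
      IsOpen {P | w i * f r + othersValue i w P r < w i * g s + othersValue i w P s} :=
    fun r s f g => isOpen_lt (continuous_const.add (continuous_othersValue i w r))
      (continuous_const.add (continuous_othersValue i w s))
  have hOopen : IsOpen O :=
    (((hlt _ _ _ _).inter (hlt _ _ _ _)).inter
      (isOpen_biInter_finset fun _ _ => hlt _ _ _ _)).inter
      (isOpen_biInter_finset fun _ _ => hlt _ _ _ _)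
  have hwi := hw i
  have hwi2 := hmax i
  have hscale : ∀ f : Fin m → ℝ, (∀ r, f r ∈ Set.Icc (0:ℝ) 1) →
      ∀ r, 0 ≤ w i * f r ∧ w i * f r ≤ w i := fun f hf r =>
    ⟨mul_nonneg hwi.le (hf r).1, mul_le_of_le_one_right hwi.le (hf r).2⟩
  have hp := hscale pi hpi
  have hph := hscale phati hphati
  have hOne : O.Nonempty := by
    obtain ⟨d, hd1, hd2⟩ : ∃ d, w i * phati q - w i * phati q' < d ∧
        d < w i * pi q - w i * pi q' := by
      apply exists_between
      have := mul_lt_mul_of_pos_left hqq' hwi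
      linarith
    have hdw : d < w i := by linarith [(hp q).2, (hp q').1]
    obtain ⟨y, hy0, hy1, hyd0, hyd1, hlow, hhigh⟩ := exists_pivotal_level hwi2
      (hph q).1 (hph q').1 (hph q).2 (hph q').2 hd1 hdw
    obtain ⟨P, hP⟩ := exists_othersValue_eq i w hwsum (by linarith)
      (fun r => if r = q then y else if r = q' then y + d else if r ∈ H then 1 - w i else 0)
      (fun r => by
        simp only [Set.mem_Icc]
        split_ifs <;> constructor <;> linarith)
    have hPq : othersValue i w P q = y := by simp [hP]
    have hPq' : othersValue i w P q' = y + d := by simp [hP, hne']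
    refine ⟨P, ⟨⟨?_, ?_⟩, ?_⟩, ?_⟩
    · simp only [Set.mem_ofPred_eq, hPq, hPq']
      linarith
    · simp only [Set.mem_ofPred_eq, hPq, hPq']
      linarith
    · simp only [Set.mem_iInter, Set.mem_ofPred_eq]
      intro h hh
      have hPh : othersValue i w P h = 1 - w i := by
        rw [hP, if_neg (ne_of_mem_of_not_mem hh hqH), if_neg (ne_of_mem_of_not_mem hh hq'H),
          if_pos hh]
      rw [hPq, hPh]
      linarith [(hph h).1]
    · simp only [Set.mem_iInter, Set.mem_ofPred_eq]
      intro l hl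
      simp only [Finset.mem_erase, Finset.mem_sdiff, Finset.mem_univ, true_and] at hl
      have hPl : othersValue i w P l = 0 := by
        rw [hP, if_neg hl.2.1, if_neg hl.1, if_neg hl.2.2]
      rw [hPq', hPl]
      linarith [(hph l).2]
  have hstrict : ∀ P ∈ O, U pi phati P < U pi pi P := by
    rintro P ⟨⟨⟨h1, h2⟩, h3⟩, h4⟩
    simp only [Set.mem_iInter, Set.mem_ofPred_eq] at h1 h2 h3 h4
    obtain ⟨hqA, hq'A⟩ := (hbest phati P).notMem_and_mem (H := H) (q := q) (q' := q')
      (by omega) hq'H (add_nonneg (hph q).1 (othersValue_nonneg i w hw P q)) h2 h3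
      (fun l hlH hlq hlq' => h4 l (by simp [hlH, hlq, hlq']))
    have hle := (hbest pi P).2 _ ((card_insert_erase_eq hqA hq'A).trans_le (hbest phati P).1)
    rw [sum_insert_erase_eq _ hqA hq'A] at hle
    rw [hUeq, hUeq]
    linarith
  have hle : ∀ P, U pi phati P ≤ U pi pi P := fun P => by
    rw [hUeq, hUeq]
    exact sub_le_sub_right ((hbest pi P).2 _ (hbest phati P).1) _
  rw [← sub_pos, ← integral_sub (hint pi pi) (hint pi phati),
    integral_pos_iff_support_of_nonneg (fun P => sub_nonneg.mpr (hle P))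
      ((hint pi pi).sub (hint pi phati))]
  exact (hfull O hOopen hOne).trans_le
    (measure_mono fun P hP => (sub_pos.mpr (hstrict P hP)).ne')
end

section
/- In the rescaled VCG scoring mechanism, for every ε > 0 there exists α₀ > 0 such that for every α with 0 < α < α₀, the worst-case deficit is at most ε: for all reports p̂ ∈ ([0,1]^m)^n and all outcomes o ∈ {0,1}^m, the total payment made by the mechanism to the recommenders, Σ_{i=1}^n α·( w_i·Σ_{q : x_q(p̂)=1} o_q − t_i(p̂) + tcomp_i(p̂_{-i}) ), is at most ε. -/
/-- A sum of values in `[0, 1]` over a subset of `Fin m` is at most `m`. -/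
lemma sum_le_of_le_one {m : ℕ} (a : Finset (Fin m)) (f : Fin m → ℝ) (hf : ∀ q, f q ≤ 1) :
    ∑ q ∈ a, f q ≤ m := by
  have hcard : (a.card : ℝ) ≤ m := by
    exact_mod_cast (Finset.card_le_univ a).trans_eq (Fintype.card_fin m)
  calc ∑ q ∈ a, f q ≤ a.card • (1 : ℝ) := Finset.sum_le_card_nsmul a f 1 fun q _ => hf q
    _ ≤ m := by simpa using hcard

/-- Total reported value of a set of recommenders for an allocation: nonnegative. -/
lemma weighted_value_nonneg {n m : ℕ} {w : Fin n → ℝ} (hw : ∀ j, 0 < w j)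
    {P : Fin n → Fin m → ℝ} (hP : ∀ j q, P j q ∈ Set.Icc (0 : ℝ) 1)
    (s : Finset (Fin n)) (a : Finset (Fin m)) :
    0 ≤ ∑ j ∈ s, ∑ q ∈ a, w j * P j q :=
  Finset.sum_nonneg fun j _ => Finset.sum_nonneg fun q _ => mul_nonneg (hw j).le (hP j q).1

/-- Total reported value of a set of recommenders for an allocation: at most `m`. -/
lemma weighted_value_le {n m : ℕ} {w : Fin n → ℝ} (hw : ∀ j, 0 < w j) (hwsum : ∑ j, w j = 1)
    {P : Fin n → Fin m → ℝ} (hP : ∀ j q, P j q ∈ Set.Icc (0 : ℝ) 1)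
    (s : Finset (Fin n)) (a : Finset (Fin m)) :
    ∑ j ∈ s, ∑ q ∈ a, w j * P j q ≤ m := by
  calc ∑ j ∈ s, ∑ q ∈ a, w j * P j q
      ≤ ∑ j, ∑ q ∈ a, w j * P j q :=
        Finset.sum_le_sum_of_subset_of_nonneg (Finset.subset_univ s) fun j _ _ =>
          Finset.sum_nonneg fun q _ => mul_nonneg (hw j).le (hP j q).1
    _ ≤ ∑ j, w j * m := by
        refine Finset.sum_le_sum fun j _ => ?_
        rw [← Finset.mul_sum]
        exact mul_le_mul_of_nonneg_left (sum_le_of_le_one a _ fun q => (hP j q).2) (hw j).le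
    _ = m := by rw [← Finset.sum_mul, hwsum, one_mul]


/-- Worst-case deficit of the rescaled VCG scoring mechanism: with a selection `x` of
value-maximizing feasible allocations, selections `xmi i P` of allocations maximizing
the others' reported value, immediate payments `t i P r` (recommender `i` reporting
`r`, others as in `P`), and rebates `tcomp i P` equal to the worst-case (maximal)
immediate payment of `i` over reports in `[0,1]^m`, for every `ε > 0` there is an
`α₀ > 0` such that for every scaling `0 < α < α₀`, all reports `P ∈ ([0,1]^m)^n` and
all repayment outcomes `o`, the total payment made by the mechanism to the
recommenders is at most `ε`. -/
theorem stmt_15 (n m K : ℕ) (hK : K ≤ m)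
    (w : Fin n → ℝ) (hw : ∀ j, 0 < w j) (hwsum : ∑ j, w j = 1)
    (x : (Fin n → Fin m → ℝ) → Finset (Fin m))
    (hx : ∀ R : Fin n → Fin m → ℝ, (x R).card ≤ K ∧
      ∀ a : Finset (Fin m), a.card ≤ K →
        (∑ j, ∑ q ∈ a, w j * R j q) ≤ ∑ j, ∑ q ∈ x R, w j * R j q)
    (xmi : Fin n → (Fin n → Fin m → ℝ) → Finset (Fin m))
    (hxmi : ∀ (i : Fin n) (P : Fin n → Fin m → ℝ), (xmi i P).card ≤ K ∧
      ∀ a : Finset (Fin m), a.card ≤ K →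
        (∑ j ∈ Finset.univ.erase i, ∑ q ∈ a, w j * P j q)
        ≤ ∑ j ∈ Finset.univ.erase i, ∑ q ∈ xmi i P, w j * P j q)
    (t : Fin n → (Fin n → Fin m → ℝ) → (Fin m → ℝ) → ℝ)
    (ht : ∀ (i : Fin n) (P : Fin n → Fin m → ℝ) (r : Fin m → ℝ), t i P r =
      (∑ j ∈ Finset.univ.erase i, ∑ q ∈ xmi i P, w j * P j q)
      - ∑ j ∈ Finset.univ.erase i, ∑ q ∈ x (Function.update P i r), w j * P j q)
    (tcomp : Fin n → (Fin n → Fin m → ℝ) → ℝ)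
    (htcomp : ∀ (i : Fin n) (P : Fin n → Fin m → ℝ), IsGreatest
      {y : ℝ | ∃ r : Fin m → ℝ, (∀ q, r q ∈ Set.Icc (0:ℝ) 1) ∧ y = t i P r}
      (tcomp i P))
    (ε : ℝ) (hε : 0 < ε) :
    ∃ α₀ > (0:ℝ), ∀ α : ℝ, 0 < α → α < α₀ →
      ∀ P : Fin n → Fin m → ℝ, (∀ j q, P j q ∈ Set.Icc (0:ℝ) 1) →
      ∀ o : Fin m → Bool,
        (∑ i, α * (w i * (∑ q ∈ x P, (if o q then (1:ℝ) else 0))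
          - t i P (P i) + tcomp i P)) ≤ ε := by
  have hD : (0 : ℝ) < 2 * n * m + 1 := by positivity
  refine ⟨ε / (2 * n * m + 1), div_pos hε hD, fun α hα hα₀ P hP o => ?_⟩
  have hsummand : ∀ i, α * (w i * (∑ q ∈ x P, (if o q then (1:ℝ) else 0))
      - t i P (P i) + tcomp i P) ≤ α * (2 * m) := by
    intro i
    refine mul_le_mul_of_nonneg_left ?_ hα.le
    have hwi : w i ≤ 1 := hwsum ▸
      Finset.single_le_sum (fun j _ => (hw j).le) (Finset.mem_univ i)
    have hrepay : ∑ q ∈ x P, (if o q then (1:ℝ) else 0) ≤ m :=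
      sum_le_of_le_one _ _ fun q => by split_ifs <;> norm_num
    have hreward : w i * (∑ q ∈ x P, (if o q then (1:ℝ) else 0)) ≤ m :=
      (mul_le_of_le_one_left
        (Finset.sum_nonneg fun q _ => by split_ifs <;> norm_num) hwi).trans hrepay
    have ht_nonneg : 0 ≤ t i P (P i) := by
      rw [ht, Function.update_eq_self, sub_nonneg]
      exact (hxmi i P).2 _ (hx P).1
    obtain ⟨r, -, hr⟩ := (htcomp i P).1
    have hcomp : tcomp i P ≤ m := by
      rw [hr, ht]
      linarith [weighted_value_le hw hwsum hP (Finset.univ.erase i) (xmi i P),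
        weighted_value_nonneg hw hP (Finset.univ.erase i) (x (Function.update P i r))]
    linarith
  calc _ ≤ ∑ _i : Fin n, α * (2 * m) := Finset.sum_le_sum fun i _ => hsummand i
    _ = α * (2 * n * m) := by
        rw [Finset.sum_const, Finset.card_univ, Fintype.card_fin, nsmul_eq_mul]
        ring
    _ ≤ α * (2 * n * m + 1) := by nlinarith
    _ ≤ ε := ((lt_div_iff₀ hD).1 hα₀).le
end

section
/- In the VCG scoring mechanism, a truthful recommender's utility strictly increases in its own weight: fix reports p̂_{-i} of the others, beliefs p_i ∈ [0,1]^m reported truthfully by i, and weights w with w_j > 0 for all j; let w' agree with w except w'_i > w_i. Let x be any feasible allocation maximizing w_i·Σ_q a_q p_{iq} + Σ_{j≠i} Σ_q a_q w_j p̂_{jq}, let x' be any feasible allocation maximizing w'_i·Σ_q a_q p_{iq} + Σ_{j≠i} Σ_q a_q w_j p̂_{jq}, and assume Σ_{q : x_q = 1} p_{iq} > 0. Then w'_i·Σ_{q : x'_q=1} p_{iq} − t'_i > w_i·Σ_{q : x_q=1} p_{iq} − t_i, where t_i = Σ_{j≠i} v̂_j(x^{-i}) − Σ_{j≠i} v̂_j(x),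 t'_i = Σ_{j≠i} v̂_j(x^{-i}) − Σ_{j≠i} v̂_j(x'), v̂_j(a) = Σ_q a_q w_j p̂_{jq}, and x^{-i} is a feasible allocation maximizing Σ_{j≠i} v̂_j(a) (which does not depend on recommender i's weight). -/
/-- In the VCG scoring mechanism, a truthful recommender's utility strictly increases
in its own weight: fix others' reports `phat j` (`j ≠ i`), truthful beliefs `p` of
recommender `i`, positive weights `w`, and `w'` agreeing with `w` except
`w' i > w i`.  Let `x` (resp. `x'`) be any feasible allocation (cardinality at most
`K`) maximizing total reported value under weight `w i` (resp. `w' i`) for `i`, let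
`xmi` be any feasible allocation maximizing the others' reported value (independent
of `i`'s weight), and assume the truthful value of the `w`-allocation is positive
(`∑ q ∈ x, p q > 0`).  Then `i`'s VCG utility under `w'` strictly exceeds that
under `w`. -/
theorem stmt_16 (n m K : ℕ) (hK : K ≤ m)
    (i : Fin n)
    (w w' : Fin n → ℝ) (hw : ∀ j, 0 < w j)
    (hagree : ∀ j, j ≠ i → w' j = w j) (hwi : w i < w' i)
    (p : Fin m → ℝ) (hp : ∀ q, p q ∈ Set.Icc (0:ℝ) 1)
    (phat : Fin n → Fin m → ℝ) (hphat : ∀ j q, phat j q ∈ Set.Icc (0:ℝ) 1)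
    (x x' xmi : Finset (Fin m))
    (hx : x.card ≤ K ∧ ∀ a : Finset (Fin m), a.card ≤ K →
      w i * (∑ q ∈ a, p q) + (∑ j ∈ Finset.univ.erase i, ∑ q ∈ a, w j * phat j q)
      ≤ w i * (∑ q ∈ x, p q) + ∑ j ∈ Finset.univ.erase i, ∑ q ∈ x, w j * phat j q)
    (hx' : x'.card ≤ K ∧ ∀ a : Finset (Fin m), a.card ≤ K →
      w' i * (∑ q ∈ a, p q) + (∑ j ∈ Finset.univ.erase i, ∑ q ∈ a, w j * phat j q)
      ≤ w' i * (∑ q ∈ x', p q) + ∑ j ∈ Finset.univ.erase i, ∑ q ∈ x', w j * phat j q)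
    (hxmi : xmi.card ≤ K ∧ ∀ a : Finset (Fin m), a.card ≤ K →
      (∑ j ∈ Finset.univ.erase i, ∑ q ∈ a, w j * phat j q)
      ≤ ∑ j ∈ Finset.univ.erase i, ∑ q ∈ xmi, w j * phat j q)
    (hpos : 0 < ∑ q ∈ x, p q) :
    w i * (∑ q ∈ x, p q)
      - ((∑ j ∈ Finset.univ.erase i, ∑ q ∈ xmi, w j * phat j q)
         - ∑ j ∈ Finset.univ.erase i, ∑ q ∈ x, w j * phat j q)
    < w' i * (∑ q ∈ x', p q)
      - ((∑ j ∈ Finset.univ.erase i, ∑ q ∈ xmi, w j * phat j q)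
         - ∑ j ∈ Finset.univ.erase i, ∑ q ∈ x', w j * phat j q) := by
  have hopt := hx'.2 x hx.1
  have hgain := mul_lt_mul_of_pos_right hwi hpos
  linarith
end
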